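/- Let G be an infinite group with a finite generating set S, and let p be a positive natural number. Then the fundamental class of G with coefficients in ℤ/pℤ is a boundary: there exists a function ψ : G × S → ZMod p such that for every v ∈ G, (∑_{s ∈ S} ψ(v·s⁻¹, s)) − (∑_{s ∈ S} ψ(v, s)) = 1. -/

import Mathlib

/-- The boundary map from 1-chains on the oriented Cayley graph of `(G, S)` to 0-chains. -/
def cayleyBoundary (R : Type*) [CommRing R] {G : Type*} [Group G] (S : Finset G) :
    (G × S → R) →ₗ[R] (G → R) where
  toFun ψ v := (∑ s : S, ψ (v * (s : G)⁻¹, s)) - ∑ s : S, ψ (v, s)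
  map_add' ψ φ := by
    ext v
    simp only [Pi.add_apply, Finset.sum_add_distrib]
    abel
  map_smul' c ψ := by
    ext v
    simp [Finset.mul_sum, mul_sub]

open Classical in
theorem cayleyBoundary_single (R : Type*) [CommRing R] {G : Type*} [Group G] (S : Finset G)
    (v : G) (s : S) :
    cayleyBoundary R S (Pi.single (v, s) 1) = Pi.single (v * s) 1 - Pi.single v 1 := by
  ext u
  have hedge (x : S) : (u * (x : G)⁻¹ = v ∧ x = s) ↔ (x = s ∧ u = v * s) := by
    rw [mul_inv_eq_iff_eq_mul, and_comm]
    exact and_congr_right fun h ↦ by rw [h]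
  simp [cayleyBoundary, Pi.single_apply, hedge, ite_and]

open Classical in
theorem single_sub_single_mem_range_cayleyBoundary (R : Type*) [CommRing R] {G : Type*} [Group G]
    (S : Finset G) (hS : Subgroup.closure (S : Set G) = ⊤) (v w : G) :
    (Pi.single v 1 - Pi.single w 1 : G → R) ∈ LinearMap.range (cayleyBoundary R S) := by
  have key : ∀ g ∈ Subgroup.closure (S : Set G), ∀ v : G,
      (Pi.single (v * g) 1 - Pi.single v 1 : G → R) ∈ LinearMap.range (cayleyBoundary R S) := by
    intro g hg
    induction hg using Subgroup.closure_induction with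
    | mem s hs => exact fun v ↦ ⟨_, cayleyBoundary_single R S v ⟨s, hs⟩⟩
    | one => simp
    | mul a b _ _ ha hb =>
      intro v
      have := add_mem (hb (v * a)) (ha v)
      rwa [sub_add_sub_cancel, mul_assoc] at this
    | inv a _ ha =>
      intro v
      have := neg_mem (ha (v * a⁻¹))
      rwa [neg_sub, inv_mul_cancel_right] at this
  simpa using key (w⁻¹ * v) (hS ▸ Subgroup.mem_top _) w

theorem exists_cayleyBoundary_eq_one_on (R : Type*) [CommRing R] {G : Type*} [Group G] [Infinite G]
    (S : Finset G) (hS : Subgroup.closure (S : Set G) = ⊤) (F : Finset G) :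
    ∃ ψ : G × S → R, ∀ v ∈ F, cayleyBoundary R S ψ v = 1 := by
  classical
  obtain ⟨w, hw⟩ := Infinite.exists_notMem_finset F
  obtain ⟨ψ, hψ⟩ := sum_mem fun v (_ : v ∈ F) ↦
    single_sub_single_mem_range_cayleyBoundary R S hS v w
  refine ⟨ψ, fun v hv ↦ ?_⟩
  have hvw : v ≠ w := fun h ↦ hw (h ▸ hv)
  simp [hψ, Finset.sum_apply, Pi.single_apply, hv, hvw]

/-- Over a finite ring, the all-ones 0-chain on an infinite Cayley graph is a boundary. -/
theorem exists_cayleyBoundary_eq_one (R : Type*) [CommRing R] [Finite R] {G : Type*} [Group G]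
    [Infinite G] (S : Finset G) (hS : Subgroup.closure (S : Set G) = ⊤) :
    ∃ ψ : G × S → R, cayleyBoundary R S ψ = 1 := by
  let : TopologicalSpace R := ⊥
  have : DiscreteTopology R := ⟨rfl⟩
  have hclosed (v : G) : IsClosed {ψ : G × S → R | cayleyBoundary R S ψ v = 1} := by
    refine isClosed_eq ?_ continuous_const
    change Continuous fun ψ : G × S → R ↦ (∑ s : S, ψ (v * (s : G)⁻¹, s)) - ∑ s : S, ψ (v, s)
    fun_prop
  obtain ⟨ψ, hψ⟩ := CompactSpace.iInter_nonempty hclosed fun F ↦ by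
    obtain ⟨ψ, hψ⟩ := exists_cayleyBoundary_eq_one_on R S hS F
    exact ⟨ψ, Set.mem_iInter₂.2 hψ⟩
  exact ⟨ψ, funext fun v ↦ Set.mem_iInter.1 hψ v⟩

/-- For an infinite finitely generated group `G` (generated by a
finite set `S`) and `p > 0`, the fundamental class (the 0-chain with value `1`
at every vertex) with coefficients in `ZMod p` is the boundary of a 1-chain
supported on the Cayley graph edges. -/
theorem fundamental_class_is_boundary
    (G : Type*) [Group G] [Infinite G] (S : Finset G)
    (hS : Subgroup.closure (S : Set G) = ⊤) (p : ℕ) (hp : 0 < p) :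
    ∃ ψ : G × S → ZMod p, ∀ v : G,
      (∑ s : S, ψ (v * (s : G)⁻¹, s)) - ∑ s : S, ψ (v, s) = 1 := by
  have : NeZero p := ⟨hp.ne'⟩
  obtain ⟨ψ, hψ⟩ := exists_cayleyBoundary_eq_one (ZMod p) S hS
  exact ⟨ψ, congrFun hψ⟩
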